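/- Klainerman–Sobolev inequality on hyperboloids: There is a universal constant C > 0 such that for all 2 ≤ s₀ ≤ s₁, every smooth function u defined on K_{[s₀,s₁]} vanishing on a neighborhood of the boundary {r = t−1}, and every s ∈ [s₀,s₁]: sup_{(t,x) ∈ H_s ∩ K} t^{3/2} |u(t,x)| ≤ C Σ_{|I|+|J| ≤ 2} ‖∂^I L^J u‖_{L²_f(H_s)}, where the sum runs over all compositions ∂^I of the operators {∂_t, ∂_1, ∂_2, ∂_3} of length |I| and all compositions L^J of the Lorentz boosts {L_1, L_2, L_3} of length |J| with |I| + |J| ≤ 2. -/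

import Mathlib

noncomputable section
open MeasureTheory

/-- Spatial radius `r = |x|` of a space-time point `p = (t, x) ∈ ℝ^{1+3}`. -/
def rad (p : Fin 4 → ℝ) : ℝ := Real.sqrt (∑ a : Fin 3, (p a.succ) ^ 2)

/-- Partial derivative in the `i`-th coordinate direction (`0` is time). -/
def pd (i : Fin 4) (u : (Fin 4 → ℝ) → ℝ) : (Fin 4 → ℝ) → ℝ :=
  fun p => fderiv ℝ u p (Pi.single i 1)

/-- The flat wave operator `□u = ∂_t∂_t u - Σ_a ∂_a∂_a u`. -/
def box (u : (Fin 4 → ℝ) → ℝ) : (Fin 4 → ℝ) → ℝ :=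
  fun p => pd 0 (pd 0 u) p - ∑ a : Fin 3, pd a.succ (pd a.succ u) p

/-- The point of the hyperboloid `H_s` above `x ∈ ℝ³`: `(√(s² + |x|²), x)`. -/
def hpt (s : ℝ) (x : Fin 3 → ℝ) : Fin 4 → ℝ :=
  Fin.cons (Real.sqrt (s ^ 2 + ∑ a : Fin 3, (x a) ^ 2)) x

/-- The flat `L²` norm on the hyperboloid `H_s`:
`‖w‖_{L²_f(H_s)} = (∫_{ℝ³} |w(√(s²+|x|²), x)|² dx)^{1/2}`. -/
def L2f (s : ℝ) (w : (Fin 4 → ℝ) → ℝ) : ℝ :=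
  Real.sqrt (∫ x : Fin 3 → ℝ, (w (hpt s x)) ^ 2)

/-- The region `K_{[s₀,s₁]} = {(t,x) : s₀² ≤ t² - r² ≤ s₁², r < t - 1}`. -/
def Kset (s₀ s₁ : ℝ) : Set (Fin 4 → ℝ) :=
  {p | s₀ ^ 2 ≤ (p 0) ^ 2 - (rad p) ^ 2 ∧ (p 0) ^ 2 - (rad p) ^ 2 ≤ s₁ ^ 2 ∧ rad p < p 0 - 1}

/-- `u` vanishes on a neighborhood of the boundary `{r = t - 1}` (and outside the cone). -/
def vanishNearBdry (u : (Fin 4 → ℝ) → ℝ) : Prop :=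
  ∃ δ > 0, ∀ p : Fin 4 → ℝ, p 0 - 1 - δ ≤ rad p → u p = 0

/-- The standard hyperboloidal energy `E_c(s,u)`. -/
def Ec (c s : ℝ) (u : (Fin 4 → ℝ) → ℝ) : ℝ :=
  ∫ x : Fin 3 → ℝ,
    ((pd 0 u (hpt s x)) ^ 2 + (∑ a : Fin 3, (pd a.succ u (hpt s x)) ^ 2)
      + 2 * (∑ a : Fin 3, (x a / hpt s x 0) * pd 0 u (hpt s x) * pd a.succ u (hpt s x))
      + c ^ 2 * (u (hpt s x)) ^ 2)

/-- The semi-hyperboloidal derivative `∂̲_a u = (x^a/t) ∂_t u + ∂_a u`. -/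
def sdu (a : Fin 3) (u : (Fin 4 → ℝ) → ℝ) : (Fin 4 → ℝ) → ℝ :=
  fun p => (p a.succ / p 0) * pd 0 u p + pd a.succ u p

/-- `Ku = s(s/t) ∂_t u + 2 Σ_a x^a ∂̲_a u`, with `s = √(t² - r²)`. -/
def Kop (u : (Fin 4 → ℝ) → ℝ) : (Fin 4 → ℝ) → ℝ :=
  fun p =>
    Real.sqrt ((p 0) ^ 2 - (rad p) ^ 2) * (Real.sqrt ((p 0) ^ 2 - (rad p) ^ 2) / p 0)
        * pd 0 u p
      + 2 * ∑ a : Fin 3, p a.succ * sdu a u p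

/-- The hyperboloidal conformal energy `E_con(s,u)`. -/
def Econ (s : ℝ) (u : (Fin 4 → ℝ) → ℝ) : ℝ :=
  ∫ x : Fin 3 → ℝ,
    ((Kop u (hpt s x) + 2 * u (hpt s x)) ^ 2
      + ∑ a : Fin 3, (s * sdu a u (hpt s x)) ^ 2)

/-- The Lorentz boost `L_a = x^a ∂_t + t ∂_a`. -/
def Lop (a : Fin 3) (u : (Fin 4 → ℝ) → ℝ) : (Fin 4 → ℝ) → ℝ :=
  fun p => p a.succ * pd 0 u p + p 0 * pd a.succ u p

/-- Composition `∂^I` of coordinate derivatives given by the word `I : Fin n → Fin 4`. -/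
def pdIter : (n : ℕ) → (Fin n → Fin 4) → ((Fin 4 → ℝ) → ℝ) → ((Fin 4 → ℝ) → ℝ)
  | 0, _, u => u
  | n + 1, I, u => pd (I 0) (pdIter n (fun k => I k.succ) u)

/-- Composition `L^J` of Lorentz boosts given by the word `J : Fin m → Fin 3`. -/
def LIter : (m : ℕ) → (Fin m → Fin 3) → ((Fin 4 → ℝ) → ℝ) → ((Fin 4 → ℝ) → ℝ)
  | 0, _, u => u
  | m + 1, J, u => Lop (J 0) (LIter m (fun k => J k.succ) u)

theorem lintegral_eq_lintegral_toSphere {E : Type*} [NormedAddCommGroup E] [NormedSpace ℝ E]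
    [MeasurableSpace E] [BorelSpace E] [FiniteDimensional ℝ E] [Nontrivial E]
    (μ : Measure E) [μ.IsAddHaarMeasure] {g : E → ENNReal} (hg : Measurable g) :
    ∫⁻ y, g y ∂μ = ∫⁻ ω : Metric.sphere (0 : E) 1, (∫⁻ r in Set.Ioi (0 : ℝ),
      ENNReal.ofReal (r ^ (Module.finrank ℝ E - 1)) * g (r • (ω : E))) ∂μ.toSphere := by
  have hmeas : Measurable fun p : Metric.sphere (0 : E) 1 × Set.Ioi (0 : ℝ) =>
      g ((p.2 : ℝ) • (p.1 : E)) := by fun_prop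
  calc ∫⁻ y, g y ∂μ = ∫⁻ y in ({0}ᶜ : Set E), g y ∂μ := by
        rw [restrict_compl_singleton]
    _ = ∫⁻ y : ({0}ᶜ : Set E), g y ∂(μ.comap (↑)) :=
        (lintegral_subtype_comap (measurableSet_singleton _).compl g).symm
    _ = ∫⁻ p : Metric.sphere (0 : E) 1 × Set.Ioi (0 : ℝ), g ((p.2 : ℝ) • (p.1 : E))
          ∂(μ.toSphere.prod (Measure.volumeIoiPow (Module.finrank ℝ E - 1))) := by
        rw [← (μ.measurePreserving_homeomorphUnitSphereProd).lintegral_comp hmeas]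
        refine lintegral_congr fun y => ?_
        have hy : ‖(y : E)‖ ≠ 0 := norm_ne_zero_iff.2 y.2
        simp [smul_smul, hy]
    _ = _ := by
        rw [lintegral_prod _ hmeas.aemeasurable]
        refine lintegral_congr fun ω => ?_
        rw [Measure.volumeIoiPow, lintegral_withDensity_eq_lintegral_mul _ (by fun_prop)
          (by fun_prop)]
        exact lintegral_subtype_comap measurableSet_Ioi
          (fun r : ℝ => ENNReal.ofReal (r ^ (Module.finrank ℝ E - 1)) * g (r • (ω : E)))

/-- A lower bound for the weighted integrals along all rays issued from `x₀` bounds the integral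
over the whole space. -/
theorem mul_toSphere_le_integral {c R : ℝ} (hc : 0 ≤ c) (hR : 0 ≤ R)
    {q : (Fin 3 → ℝ) → ℝ} (hq : Continuous q)
    (hq0 : ∀ y, 0 ≤ q y) (hqi : Integrable q) (x₀ : Fin 3 → ℝ)
    (h : ∀ ω : Fin 3 → ℝ, ‖ω‖ = 1 → c ≤ ∫ r in (0:ℝ)..R, r ^ 2 * q (x₀ + r • ω)) :
    c * (volume : Measure (Fin 3 → ℝ)).toSphere.real Set.univ ≤ ∫ y, q y := by
  have key : ENNReal.ofReal c * (volume : Measure (Fin 3 → ℝ)).toSphere Set.univ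
      ≤ ∫⁻ y, ENNReal.ofReal (q y) := by
    rw [← lintegral_add_left_eq_self (fun y => ENNReal.ofReal (q y)) x₀,
      lintegral_eq_lintegral_toSphere volume (g := fun y => ENNReal.ofReal (q (x₀ + y)))
        (by fun_prop), ← lintegral_const]
    refine lintegral_mono fun ω => ?_
    have hω : ‖(ω : Fin 3 → ℝ)‖ = 1 := by simp
    refine (ENNReal.ofReal_le_ofReal (h ω hω)).trans ?_
    have hcont : Continuous fun r : ℝ => r ^ 2 * q (x₀ + r • (ω : Fin 3 → ℝ)) := by fun_prop
    rw [intervalIntegral.integral_of_le hR, ofReal_integral_eq_lintegral_ofReal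
      ((hcont.intervalIntegrable 0 R).1)
      (ae_of_all _ fun r => mul_nonneg (sq_nonneg _) (hq0 _))]
    refine (lintegral_mono_set Set.Ioc_subset_Ioi_self).trans (le_of_eq ?_)
    refine lintegral_congr fun r => ?_
    rw [ENNReal.ofReal_mul (sq_nonneg _)]
    simp
  rw [← ofReal_integral_eq_lintegral_ofReal hqi (ae_of_all _ hq0),
    ← ENNReal.ofReal_toReal (measure_ne_top _ _), ← ENNReal.ofReal_mul hc] at key
  exact (ENNReal.ofReal_le_ofReal_iff (integral_nonneg hq0)).1 key

theorem sq_integral_le {R : ℝ} (hR : 0 < R) {g : ℝ → ℝ} (hg : Continuous g) :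
    (∫ r in (0:ℝ)..R, g r) ^ 2 ≤ R * ∫ r in (0:ℝ)..R, g r ^ 2 := by
  set m := (∫ r in (0:ℝ)..R, g r) / R with hm
  have hI : ∫ r in (0:ℝ)..R, g r = m * R := by rw [hm]; field_simp
  have h0 : 0 ≤ ∫ r in (0:ℝ)..R, (g r - m) ^ 2 :=
    intervalIntegral.integral_nonneg hR.le fun r _ => sq_nonneg _
  have h1 : ∫ r in (0:ℝ)..R, (g r - m) ^ 2
      = (∫ r in (0:ℝ)..R, g r ^ 2) - 2 * m * (∫ r in (0:ℝ)..R, g r) + m ^ 2 * R := by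
    have : ∀ r, (g r - m) ^ 2 = g r ^ 2 - 2 * m * g r + m ^ 2 := fun r => by ring
    simp_rw [this]
    rw [intervalIntegral.integral_add, intervalIntegral.integral_sub,
      intervalIntegral.integral_const_mul, intervalIntegral.integral_const]
    · simp [mul_comm]
    all_goals exact Continuous.intervalIntegrable (by fun_prop) _ _
  rw [h1, hI] at h0
  rw [hI]
  nlinarith

/-- One-dimensional weighted Sobolev inequality on `[0, R]`. -/
theorem sq_le_integral_of_second_derivative {R M : ℝ} (hR : 0 < R)
    {f f' f'' : ℝ → ℝ} (hf : ∀ r, HasDerivAt f (f' r) r) (hf' : ∀ r, HasDerivAt f' (f'' r) r)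
    (hf'' : Continuous f'') {q : ℝ → ℝ} (hq : Continuous q)
    (hM : ∀ r ∈ Set.Icc 0 R,
      (2 / R ^ 2 * |f r| + 4 / R * |f' r| + |f'' r|) ^ 2 ≤ M * q r) :
    f 0 ^ 2 ≤ R * M * ∫ r in (0:ℝ)..R, r ^ 2 * q r := by
  have cf : Continuous f := continuous_iff_continuousAt.2 fun r => (hf r).continuousAt
  have cf' : Continuous f' := continuous_iff_continuousAt.2 fun r => (hf' r).continuousAt
  set h'' : ℝ → ℝ := fun r => 2 / R ^ 2 * f r - 4 / R * (1 - r / R) * f' r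
    + (1 - r / R) ^ 2 * f'' r with hh''
  have ch'' : Continuous h'' := by fun_prop
  have hderiv : ∀ r, HasDerivAt (fun r => r * (-(2 / R) * (1 - r / R) * f r
      + (1 - r / R) ^ 2 * f' r) - (1 - r / R) ^ 2 * f r) (r * h'' r) r := fun r => by
    have hl : HasDerivAt (fun r : ℝ => 1 - r / R) (-(1 / R)) r :=
      ((hasDerivAt_id r).div_const R).const_sub 1
    have := ((hasDerivAt_id r).mul (((hl.const_mul (-(2 / R))).mul (hf r)).add
      ((hl.pow 2).mul (hf' r)))).sub ((hl.pow 2).mul (hf r))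
    refine this.congr_deriv ?_
    simp [hh'']
    field_simp
    ring
  have hint : ∫ r in (0:ℝ)..R, r * h'' r = f 0 := by
    rw [intervalIntegral.integral_eq_sub_of_hasDerivAt (fun r _ => hderiv r)
      (Continuous.intervalIntegrable (by fun_prop) _ _)]
    simp [hR.ne']
  have hle : ∫ r in (0:ℝ)..R, (r * h'' r) ^ 2 ≤ ∫ r in (0:ℝ)..R, M * (r ^ 2 * q r) := by
    refine intervalIntegral.integral_mono_on hR.le
      (Continuous.intervalIntegrable (by fun_prop) _ _)
      (Continuous.intervalIntegrable (by fun_prop) _ _) fun r hr => ?_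
    have h1 : 0 ≤ 1 - r / R := by
      rw [sub_nonneg, div_le_one hR]; exact hr.2
    have h2 : 1 - r / R ≤ 1 := by
      have := div_nonneg hr.1 hR.le
      linarith
    have habs : |h'' r| ≤ 2 / R ^ 2 * |f r| + 4 / R * |f' r| + |f'' r| := by
      have e1 : |2 / R ^ 2 * f r| = 2 / R ^ 2 * |f r| := by
        rw [abs_mul, abs_of_nonneg (by positivity)]
      have e2 : |4 / R * (1 - r / R) * f' r| ≤ 4 / R * |f' r| := by
        rw [abs_mul, abs_of_nonneg (by positivity)]
        gcongr
        exact mul_le_of_le_one_right (by positivity) h2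
      have e3 : |(1 - r / R) ^ 2 * f'' r| ≤ |f'' r| := by
        rw [abs_mul, abs_of_nonneg (by positivity)]
        exact mul_le_of_le_one_left (abs_nonneg _) (pow_le_one₀ h1 h2)
      calc |h'' r| ≤ |2 / R ^ 2 * f r - 4 / R * (1 - r / R) * f' r|
            + |(1 - r / R) ^ 2 * f'' r| := abs_add_le _ _
        _ ≤ |2 / R ^ 2 * f r| + |4 / R * (1 - r / R) * f' r|
            + |(1 - r / R) ^ 2 * f'' r| := by gcongr; exact abs_sub _ _
        _ ≤ _ := by rw [e1]; gcongr
    calc (r * h'' r) ^ 2 = r ^ 2 * |h'' r| ^ 2 := by rw [mul_pow, sq_abs]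
      _ ≤ r ^ 2 * (M * q r) := by
          gcongr
          exact (pow_le_pow_left₀ (abs_nonneg _) habs 2).trans (hM r hr)
      _ = _ := by ring
  rw [intervalIntegral.integral_const_mul] at hle
  calc f 0 ^ 2 = (∫ r in (0:ℝ)..R, r * h'' r) ^ 2 := by rw [hint]
    _ ≤ R * ∫ r in (0:ℝ)..R, (r * h'' r) ^ 2 := sq_integral_le hR (by fun_prop)
    _ ≤ _ := by rw [mul_assoc]; gcongr

theorem continuous_rad : Continuous rad := by
  unfold rad
  fun_prop

/-- Smooth functions vanishing in the open set `{r > t - 1 - δ}`. -/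
def SmoothInCone (δ : ℝ) (w : (Fin 4 → ℝ) → ℝ) : Prop :=
  ContDiff ℝ (⊤ : ℕ∞) w ∧ ∀ p : Fin 4 → ℝ, p 0 - 1 - δ < rad p → w p = 0

theorem SmoothInCone.partialDeriv {δ : ℝ} {w : (Fin 4 → ℝ) → ℝ} (hw : SmoothInCone δ w) (i : Fin 4) :
    SmoothInCone δ (pd i w) := by
  refine ⟨(hw.1.fderiv_right (by simp)).clm_apply contDiff_const, fun p hp => ?_⟩
  have ho : IsOpen {p : Fin 4 → ℝ | p 0 - 1 - δ < rad p} :=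
    isOpen_lt (by fun_prop) continuous_rad
  have : w =ᶠ[nhds p] fun _ => 0 := Filter.eventuallyEq_of_mem (ho.mem_nhds hp) hw.2
  simp [pd, this.fderiv_eq]

theorem SmoothInCone.boost {δ : ℝ} {w : (Fin 4 → ℝ) → ℝ} (hw : SmoothInCone δ w) (a : Fin 3) :
    SmoothInCone δ (Lop a w) := by
  refine ⟨?_, fun p hp => ?_⟩
  · exact ((contDiff_apply ℝ ℝ a.succ).mul (hw.partialDeriv 0).1).add
      ((contDiff_apply ℝ ℝ 0).mul (hw.partialDeriv a.succ).1)
  · simp [Lop, (hw.partialDeriv 0).2 p hp, (hw.partialDeriv a.succ).2 p hp]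

theorem hpt_zero (s : ℝ) (x : Fin 3 → ℝ) :
    hpt s x 0 = Real.sqrt (s ^ 2 + ∑ a : Fin 3, (x a) ^ 2) := rfl

theorem hpt_succ (s : ℝ) (x : Fin 3 → ℝ) (a : Fin 3) : hpt s x a.succ = x a := rfl

theorem sq_hpt_zero (s : ℝ) (x : Fin 3 → ℝ) :
    hpt s x 0 ^ 2 = s ^ 2 + ∑ a : Fin 3, (x a) ^ 2 :=
  Real.sq_sqrt (by positivity)

theorem hpt_zero_pos {s : ℝ} (hs : 0 < s) (x : Fin 3 → ℝ) : 0 < hpt s x 0 :=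
  Real.sqrt_pos.2 (by positivity)

theorem rad_hpt (s : ℝ) (x : Fin 3 → ℝ) : rad (hpt s x) = Real.sqrt (∑ a : Fin 3, (x a) ^ 2) :=
  rfl

theorem continuous_hpt (s : ℝ) : Continuous (hpt s) := by
  refine continuous_pi fun i => ?_
  refine Fin.cases ?_ (fun a => ?_) i
  · simp only [hpt_zero]; fun_prop
  · simp only [hpt_succ]; fun_prop

theorem SmoothInCone.continuous_comp_hpt {δ : ℝ} {w : (Fin 4 → ℝ) → ℝ} (hw : SmoothInCone δ w)
    (s : ℝ) : Continuous fun x => w (hpt s x) :=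
  hw.1.continuous.comp (continuous_hpt s)

theorem SmoothInCone.integrable_sq {δ : ℝ} (hδ : 0 < δ) {w : (Fin 4 → ℝ) → ℝ}
    (hw : SmoothInCone δ w) {s : ℝ} (hs : 0 < s) :
    Integrable fun x => w (hpt s x) ^ 2 := by
  refine ((hw.continuous_comp_hpt s).pow 2).integrable_of_hasCompactSupport ?_
  refine HasCompactSupport.intro (isCompact_closedBall (0 : Fin 3 → ℝ) (s ^ 2)) fun x hx => ?_
  have hx : s ^ 2 < ‖x‖ := by simpa using hx
  have hr : ‖x‖ ≤ rad (hpt s x) := by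
    rw [rad_hpt, pi_norm_le_iff_of_nonneg (Real.sqrt_nonneg _)]
    exact fun a => Real.abs_le_sqrt
      (Finset.single_le_sum (f := fun a => x a ^ 2) (fun _ _ => sq_nonneg _) (Finset.mem_univ a))
  have h1 : hpt s x 0 ^ 2 = s ^ 2 + rad (hpt s x) ^ 2 := by
    rw [sq_hpt_zero, rad_hpt, Real.sq_sqrt (by positivity)]
  have : hpt s x 0 - 1 - δ < rad (hpt s x) := by
    by_contra! h
    have : 0 ≤ rad (hpt s x) := Real.sqrt_nonneg _
    nlinarith
  simp [hw.2 _ this]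

theorem hasDerivAt_hpt_zero {s : ℝ} (hs : 0 < s) (x ω : Fin 3 → ℝ) (r : ℝ) :
    HasDerivAt (fun r : ℝ => hpt s (x + r • ω) 0)
      ((∑ a, (x + r • ω) a * ω a) / hpt s (x + r • ω) 0) r := by
  have hne : s ^ 2 + ∑ a : Fin 3, ((x + r • ω) a) ^ 2 ≠ 0 := by positivity
  have hl : ∀ a, HasDerivAt (fun r : ℝ => (x + r • ω) a) (ω a) r := fun a => by
    simpa using ((hasDerivAt_id r).mul_const (ω a)).const_add (x a)
  have hsum : HasDerivAt (fun r : ℝ => s ^ 2 + ∑ a : Fin 3, ((x + r • ω) a) ^ 2)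
      (∑ a, 2 * ((x + r • ω) a * ω a)) r := by
    refine (HasDerivAt.fun_sum fun a _ => ?_).const_add _
    exact ((hl a).fun_pow 2).congr_deriv (by simp; ring)
  refine (hsum.sqrt hne).congr_deriv ?_
  rw [hpt_zero, ← Finset.mul_sum, mul_div_mul_left _ _ two_ne_zero]

/-- Derivatives along rays in the hyperboloid are combinations of the boosts. -/
theorem hasDerivAt_comp_hpt {w : (Fin 4 → ℝ) → ℝ} (hw : ContDiff ℝ (⊤ : ℕ∞) w)
    {s : ℝ} (hs : 0 < s) (x ω : Fin 3 → ℝ) (r : ℝ) :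
    HasDerivAt (fun r : ℝ => w (hpt s (x + r • ω)))
      ((∑ a, ω a * Lop a w (hpt s (x + r • ω))) / hpt s (x + r • ω) 0) r := by
  have ht := (hpt_zero_pos hs (x + r • ω)).ne'
  have hγ : HasDerivAt (fun r : ℝ => hpt s (x + r • ω))
      (Fin.cons ((∑ a, (x + r • ω) a * ω a) / hpt s (x + r • ω) 0) ω : Fin 4 → ℝ) r := by
    rw [hasDerivAt_pi]
    refine Fin.cases (hasDerivAt_hpt_zero hs x ω r) fun a => ?_
    simpa [hpt_succ] using ((hasDerivAt_id r).mul_const (ω a)).const_add (x a)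
  have hd : DifferentiableAt ℝ w (hpt s (x + r • ω)) :=
    hw.differentiable (by simp) _
  refine (hd.hasFDerivAt.comp_hasDerivAt r hγ).congr_deriv ?_
  rw [← Finset.univ_sum_single
    (Fin.cons ((∑ a, (x + r • ω) a * ω a) / hpt s (x + r • ω) 0) ω : Fin 4 → ℝ), map_sum]
  have hsingle : ∀ (i : Fin 4) (c : ℝ), fderiv ℝ w (hpt s (x + r • ω)) (Pi.single i c)
      = c * pd i w (hpt s (x + r • ω)) := fun i c => by
    rw [pd, ← smul_eq_mul, ← map_smul, ← Pi.single_smul', smul_eq_mul, mul_one]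
  simp only [hsingle, Fin.sum_univ_succ (n := 3), Fin.cons_zero, Fin.cons_succ, Lop, hpt_succ]
  rw [eq_div_iff ht, add_mul, div_mul_eq_mul_div, div_mul_cancel₀ _ ht, Finset.sum_mul,
    Finset.sum_mul, ← Finset.sum_add_distrib]
  exact Finset.sum_congr rfl fun a _ => by ring

theorem abs_sum_mul_le {ω : Fin 3 → ℝ} (hω : ‖ω‖ = 1) (g : Fin 3 → ℝ) :
    |∑ a, ω a * g a| ≤ ∑ a, |g a| := by
  refine (Finset.abs_sum_le_sum_abs _ _).trans (Finset.sum_le_sum fun a _ => ?_)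
  rw [abs_mul]
  exact mul_le_of_le_one_left (abs_nonneg _) (hω ▸ norm_le_pi_norm ω a)

/-- The sum of the squares of all compositions of at most two boosts, restricted to `H_s`. -/
def boostDensity (s : ℝ) (u : (Fin 4 → ℝ) → ℝ) (x : Fin 3 → ℝ) : ℝ :=
  u (hpt s x) ^ 2 + ∑ a, Lop a u (hpt s x) ^ 2 + ∑ a, ∑ b, Lop b (Lop a u) (hpt s x) ^ 2

theorem boostDensity_nonneg (s : ℝ) (u : (Fin 4 → ℝ) → ℝ) (x : Fin 3 → ℝ) :
    0 ≤ boostDensity s u x := by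
  unfold boostDensity
  positivity

theorem SmoothInCone.continuous_boostDensity {δ : ℝ} {u : (Fin 4 → ℝ) → ℝ}
    (hu : SmoothInCone δ u) (s : ℝ) : Continuous (boostDensity s u) := by
  have h0 := hu.continuous_comp_hpt s
  have h1 := fun a => (hu.boost a).continuous_comp_hpt s
  have h2 := fun a b => ((hu.boost a).boost b).continuous_comp_hpt s
  exact ((h0.pow 2).add (continuous_finsetSum _ fun a _ => (h1 a).pow 2)).add
    (continuous_finsetSum _ fun a _ => continuous_finsetSum _ fun b _ => (h2 a b).pow 2)

theorem sq_abs_add_sum_abs_le_boostDensity (s : ℝ) (u : (Fin 4 → ℝ) → ℝ) (x : Fin 3 → ℝ) :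
    (|u (hpt s x)| + ∑ a, |Lop a u (hpt s x)| + ∑ a, ∑ b, |Lop b (Lop a u) (hpt s x)|) ^ 2
      ≤ 13 * boostDensity s u x := by
  have hcs : ∀ g : Fin 3 → ℝ, (∑ a, |g a|) ^ 2 ≤ 3 * ∑ a, g a ^ 2 := fun g => by
    simpa using sq_sum_le_card_mul_sum_sq (s := Finset.univ) (f := fun a => |g a|)
  have h1 := hcs fun a => Lop a u (hpt s x)
  have h2 : (∑ a, ∑ b, |Lop b (Lop a u) (hpt s x)|) ^ 2
      ≤ 9 * ∑ a, ∑ b, Lop b (Lop a u) (hpt s x) ^ 2 := by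
    have := hcs fun a => ∑ b, |Lop b (Lop a u) (hpt s x)|
    have hp : ∀ a, abs (∑ b, |Lop b (Lop a u) (hpt s x)|) = ∑ b, |Lop b (Lop a u) (hpt s x)| :=
      fun a => abs_of_nonneg (by positivity)
    simp only [hp] at this
    refine this.trans ?_
    have h3 : ∑ a, (∑ b, |Lop b (Lop a u) (hpt s x)|) ^ 2
        ≤ ∑ a, 3 * ∑ b, Lop b (Lop a u) (hpt s x) ^ 2 :=
      Finset.sum_le_sum fun a _ => hcs fun b => Lop b (Lop a u) (hpt s x)
    rw [← Finset.mul_sum] at h3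
    linarith
  unfold boostDensity
  set A := |u (hpt s x)| with hA
  set B := ∑ a, |Lop a u (hpt s x)|
  set D := ∑ a, ∑ b, |Lop b (Lop a u) (hpt s x)|
  rw [← sq_abs (u (hpt s x)), ← hA]
  nlinarith [sq_nonneg (3 * A - B), sq_nonneg (9 * A - D), sq_nonneg (3 * B - D)]

/-- On the rays of sup-norm length `t₀ / 4` the time function of the hyperboloid stays
comparable to its initial value `t₀`. -/
theorem half_hpt_zero_le {s : ℝ} (hs : 0 < s) (x : Fin 3 → ℝ) {ω : Fin 3 → ℝ} (hω : ‖ω‖ = 1)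
    {r : ℝ} (hr : r ∈ Set.Icc 0 (hpt s x 0 / 4)) :
    hpt s x 0 / 2 ≤ hpt s (x + r • ω) 0 := by
  have ht := hpt_zero_pos hs x
  refine le_of_sq_le_sq ?_ (hpt_zero_pos hs _).le
  have h1 := sq_hpt_zero s x
  rw [sq_hpt_zero]
  have h2 : ∀ a, x a ^ 2 / 2 - (hpt s x 0 / 4) ^ 2 ≤ (x + r • ω) a ^ 2 := fun a => by
    have hωa : |ω a| ≤ 1 := hω ▸ norm_le_pi_norm ω a
    have h3 : (r * ω a) ^ 2 ≤ (hpt s x 0 / 4) ^ 2 := by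
      rw [sq_le_sq, abs_mul, abs_of_nonneg hr.1, abs_of_pos (show 0 < hpt s x 0 / 4 by linarith)]
      nlinarith [hr.1, hr.2, abs_nonneg (ω a)]
    simp only [Pi.add_apply, Pi.smul_apply, smul_eq_mul]
    nlinarith [sq_nonneg (x a + 2 * (r * ω a))]
  have h4 := Finset.sum_le_sum fun a (_ : a ∈ (Finset.univ : Finset (Fin 3))) => h2 a
  rw [Finset.sum_sub_distrib, ← Finset.sum_div] at h4
  simp only [Finset.sum_const, Finset.card_univ, Fintype.card_fin, nsmul_eq_mul] at h4
  push_cast at h4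
  nlinarith [sq_nonneg s]

theorem SmoothInCone.cube_mul_sq_le {δ : ℝ} {u : (Fin 4 → ℝ) → ℝ} (hu : SmoothInCone δ u)
    {s : ℝ} (hs : 0 < s) (x : Fin 3 → ℝ) {ω : Fin 3 → ℝ} (hω : ‖ω‖ = 1) :
    hpt s x 0 ^ 3 * u (hpt s x) ^ 2 / 6292
      ≤ ∫ r in (0:ℝ)..(hpt s x 0 / 4), r ^ 2 * boostDensity s u (x + r • ω) := by
  have ht0 := hpt_zero_pos hs x
  set T := hpt s x 0
  set τ : ℝ → ℝ := fun r => hpt s (x + r • ω) 0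
  have hτ0 : ∀ r, 0 < τ r := fun r => hpt_zero_pos hs _
  set m : ℝ → ℝ := fun r => ∑ a, (x + r • ω) a * ω a with hm
  set g : Fin 3 → ℝ → ℝ := fun a r => Lop a u (hpt s (x + r • ω))
  set k : Fin 3 → Fin 3 → ℝ → ℝ := fun a b r => Lop b (Lop a u) (hpt s (x + r • ω))
  have hline : Continuous fun r : ℝ => x + r • ω := by fun_prop
  have cτ : Continuous τ := (continuous_apply 0).comp ((continuous_hpt s).comp hline)
  have cg : ∀ a, Continuous (g a) := fun a => ((hu.boost a).continuous_comp_hpt s).comp hline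
  have ck : ∀ a b, Continuous (k a b) := fun a b =>
    (((hu.boost a).boost b).continuous_comp_hpt s).comp hline
  have hf : ∀ r, HasDerivAt (fun r : ℝ => u (hpt s (x + r • ω)))
      ((∑ a, ω a * g a r) / τ r) r := fun r => hasDerivAt_comp_hpt hu.1 hs x ω r
  have hf' : ∀ r, HasDerivAt (fun r => (∑ a, ω a * g a r) / τ r)
      (((∑ a, ω a * ((∑ b, ω b * k a b r) / τ r)) * τ r
        - (∑ a, ω a * g a r) * (m r / τ r)) / τ r ^ 2) r := fun r =>
    (HasDerivAt.fun_sum fun a _ =>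
      (hasDerivAt_comp_hpt (hu.boost a).1 hs x ω r).const_mul (ω a)).fun_div
      (hasDerivAt_hpt_zero hs x ω r) (hτ0 r).ne'
  have hcont : Continuous fun r => ((∑ a, ω a * ((∑ b, ω b * k a b r) / τ r)) * τ r
      - (∑ a, ω a * g a r) * (m r / τ r)) / τ r ^ 2 := by
    have h1 : ∀ r, τ r ≠ 0 := fun r => (hτ0 r).ne'
    have h2 : ∀ r, τ r ^ 2 ≠ 0 := fun r => pow_ne_zero 2 (h1 r)
    fun_prop (disch := assumption)
  have key := sq_le_integral_of_second_derivative (R := T / 4) (M := 13 * (44 / T ^ 2) ^ 2)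
    (by positivity) hf hf' hcont (q := fun r => boostDensity s u (x + r • ω))
    ((hu.continuous_boostDensity s).comp hline) fun r hr => by
      have hle : T / 2 ≤ τ r := half_hpt_zero_le hs x hω hr
      have hτr := hτ0 r
      have hinv : 1 / τ r ≤ 2 / T := by
        rw [div_le_div_iff₀ hτr ht0]; linarith
      have hinv2 : 1 / τ r ^ 2 ≤ 4 / T ^ 2 := by
        have := pow_le_pow_left₀ (by positivity) hinv 2
        calc 1 / τ r ^ 2 = (1 / τ r) ^ 2 := by ring
          _ ≤ (2 / T) ^ 2 := this
          _ = _ := by ring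
      set A := |u (hpt s (x + r • ω))|
      set B := ∑ a, |g a r|
      set D := ∑ a, ∑ b, |k a b r|
      have hA0 : 0 ≤ A := abs_nonneg _
      have hB0 : 0 ≤ B := by positivity
      have hD0 : 0 ≤ D := by positivity
      have h1 : |∑ a, ω a * g a r| ≤ B := abs_sum_mul_le hω fun a => g a r
      have h2 : |∑ a, ω a * (∑ b, ω b * k a b r)| ≤ D :=
        (abs_sum_mul_le hω fun a => ∑ b, ω b * k a b r).trans
          (Finset.sum_le_sum fun a _ => abs_sum_mul_le hω fun b => k a b r)
      have h3 : |m r| ≤ 3 * τ r := by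
        have hxa : ∀ a, |(x + r • ω) a| ≤ τ r := fun a => by
          refine Real.abs_le_sqrt ?_
          have := Finset.single_le_sum (f := fun a => (x + r • ω) a ^ 2)
            (fun _ _ => sq_nonneg _) (Finset.mem_univ a)
          nlinarith [sq_nonneg s]
        have h4 : |m r| ≤ ∑ a, |(x + r • ω) a| := by
          simp only [hm, mul_comm _ (ω _)]
          exact abs_sum_mul_le hω fun a => (x + r • ω) a
        have h5 := Finset.sum_le_sum fun a (_ : a ∈ (Finset.univ : Finset (Fin 3))) => hxa a
        simp only [Finset.sum_const, Finset.card_univ, Fintype.card_fin, nsmul_eq_mul] at h5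
        exact h4.trans (by exact_mod_cast h5)
      have e1 : |(∑ a, ω a * g a r) / τ r| ≤ 2 / T * B := by
        rw [abs_div, abs_of_pos hτr, div_eq_mul_one_div, mul_comm]
        gcongr
      have e2 : |((∑ a, ω a * ((∑ b, ω b * k a b r) / τ r)) * τ r
          - (∑ a, ω a * g a r) * (m r / τ r)) / τ r ^ 2| ≤ 4 / T ^ 2 * (D + B * 3) := by
        have h6 : (∑ a, ω a * ((∑ b, ω b * k a b r) / τ r)) * τ r
            = ∑ a, ω a * (∑ b, ω b * k a b r) := by
          rw [Finset.sum_mul]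
          refine Finset.sum_congr rfl fun a _ => ?_
          field_simp
        have h7 : |m r / τ r| ≤ 3 := by
          rw [abs_div, abs_of_pos hτr, div_le_iff₀ hτr]
          exact h3
        rw [h6, abs_div, abs_of_pos (pow_pos hτr 2), div_eq_mul_one_div, mul_comm]
        gcongr
        refine (abs_sub _ _).trans ?_
        rw [abs_mul]
        gcongr
      have e3 : 2 / (T / 4) ^ 2 * A + 4 / (T / 4) * |(∑ a, ω a * g a r) / τ r|
          + |((∑ a, ω a * ((∑ b, ω b * k a b r) / τ r)) * τ r
            - (∑ a, ω a * g a r) * (m r / τ r)) / τ r ^ 2| ≤ 44 / T ^ 2 * (A + B + D) := by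
        calc _ ≤ 2 / (T / 4) ^ 2 * A + 4 / (T / 4) * (2 / T * B)
              + 4 / T ^ 2 * (D + B * 3) := by gcongr
          _ = (32 * A + 44 * B + 4 * D) / T ^ 2 := by field_simp; ring
          _ ≤ (44 * (A + B + D)) / T ^ 2 := by gcongr; linarith
          _ = _ := by ring
      calc _ ≤ (44 / T ^ 2 * (A + B + D)) ^ 2 := by gcongr
        _ = (44 / T ^ 2) ^ 2 * (A + B + D) ^ 2 := by ring
        _ ≤ (44 / T ^ 2) ^ 2 * (13 * boostDensity s u (x + r • ω)) := by
            gcongr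
            exact sq_abs_add_sum_abs_le_boostDensity s u _
        _ = _ := by ring
  simp only [zero_smul, add_zero] at key
  generalize (∫ r in (0:ℝ)..(T / 4), r ^ 2 * boostDensity s u (x + r • ω)) = N at key ⊢
  rw [div_le_iff₀ (by norm_num)]
  calc T ^ 3 * u (hpt s x) ^ 2 ≤ T ^ 3 * (T / 4 * (13 * (44 / T ^ 2) ^ 2) * N) := by gcongr
    _ = _ := by field_simp; ring

theorem L2f_LIter_le (s : ℝ) (u : (Fin 4 → ℝ) → ℝ) {m : ℕ} (hm : m < 3) (J : Fin m → Fin 3) :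
    L2f s (LIter m J u) ≤ ∑ n ∈ Finset.range 3, ∑ m ∈ Finset.range (3 - n),
      ∑ I : Fin n → Fin 4, ∑ J : Fin m → Fin 3, L2f s (pdIter n I (LIter m J u)) := by
  have h0 : ∀ w, 0 ≤ L2f s w := fun w => Real.sqrt_nonneg _
  calc L2f s (LIter m J u)
      ≤ ∑ J : Fin m → Fin 3, L2f s (LIter m J u) :=
        Finset.single_le_sum (f := fun J => L2f s (LIter m J u)) (fun _ _ => h0 _)
          (Finset.mem_univ J)
    _ = ∑ I : Fin 0 → Fin 4, ∑ J : Fin m → Fin 3, L2f s (pdIter 0 I (LIter m J u)) := by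
        simp [pdIter]
    _ ≤ ∑ m ∈ Finset.range (3 - 0), ∑ I : Fin 0 → Fin 4, ∑ J : Fin m → Fin 3,
          L2f s (pdIter 0 I (LIter m J u)) :=
        Finset.single_le_sum (f := fun m => ∑ I : Fin 0 → Fin 4, ∑ J : Fin m → Fin 3,
          L2f s (pdIter 0 I (LIter m J u)))
          (fun _ _ => Finset.sum_nonneg fun _ _ => Finset.sum_nonneg fun _ _ => h0 _)
          (Finset.mem_range.2 hm)
    _ ≤ _ := Finset.single_le_sum (f := fun n => ∑ m ∈ Finset.range (3 - n),
          ∑ I : Fin n → Fin 4, ∑ J : Fin m → Fin 3, L2f s (pdIter n I (LIter m J u)))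
          (fun _ _ => Finset.sum_nonneg fun _ _ => Finset.sum_nonneg fun _ _ =>
            Finset.sum_nonneg fun _ _ => h0 _)
          (Finset.mem_range.2 (by norm_num : 0 < 3))

theorem SmoothInCone.integrable_boostDensity {δ : ℝ} (hδ : 0 < δ) {u : (Fin 4 → ℝ) → ℝ}
    (hu : SmoothInCone δ u) {s : ℝ} (hs : 0 < s) : Integrable (boostDensity s u) :=
  ((hu.integrable_sq hδ hs).add
    (integrable_finsetSum _ fun a _ => (hu.boost a).integrable_sq hδ hs)).add
    (integrable_finsetSum _ fun a _ => integrable_finsetSum _ fun b _ =>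
      ((hu.boost a).boost b).integrable_sq hδ hs)

theorem SmoothInCone.integral_boostDensity_le {δ : ℝ} (hδ : 0 < δ) {u : (Fin 4 → ℝ) → ℝ}
    (hu : SmoothInCone δ u) {s : ℝ} (hs : 0 < s) :
    ∫ x, boostDensity s u x ≤ 13 * (∑ n ∈ Finset.range 3, ∑ m ∈ Finset.range (3 - n),
      ∑ I : Fin n → Fin 4, ∑ J : Fin m → Fin 3, L2f s (pdIter n I (LIter m J u))) ^ 2 := by
  have hL := fun m (hm : m < 3) => L2f_LIter_le s u hm
  set S := ∑ n ∈ Finset.range 3, ∑ m ∈ Finset.range (3 - n),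
    ∑ I : Fin n → Fin 4, ∑ J : Fin m → Fin 3, L2f s (pdIter n I (LIter m J u))
  have hsq : ∀ w : (Fin 4 → ℝ) → ℝ, L2f s w ≤ S → ∫ x, w (hpt s x) ^ 2 ≤ S ^ 2 := fun w hw =>
    (Real.sqrt_le_left ((Real.sqrt_nonneg _).trans hw)).1 hw
  have i0 := hu.integrable_sq hδ hs
  have i1 := fun a => (hu.boost a).integrable_sq hδ hs
  have i2 := fun a b => ((hu.boost a).boost b).integrable_sq hδ hs
  have h0 : ∫ x, u (hpt s x) ^ 2 ≤ S ^ 2 := hsq u (hL 0 (by norm_num) ![])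
  have h1 : ∀ a, ∫ x, Lop a u (hpt s x) ^ 2 ≤ S ^ 2 := fun a =>
    hsq _ (hL 1 (by norm_num) ![a])
  have h2 : ∀ a b, ∫ x, Lop b (Lop a u) (hpt s x) ^ 2 ≤ S ^ 2 := fun a b =>
    hsq _ (hL 2 (by norm_num) ![b, a])
  have s1 : Integrable fun x => ∑ a, Lop a u (hpt s x) ^ 2 := integrable_finsetSum _ fun a _ => i1 a
  have s01 : Integrable fun x => u (hpt s x) ^ 2 + ∑ a, Lop a u (hpt s x) ^ 2 := i0.add s1
  unfold boostDensity
  rw [integral_add s01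
      (integrable_finsetSum _ fun a _ => integrable_finsetSum _ fun b _ => i2 a b),
    integral_add i0 s1,
    integral_finsetSum _ fun a _ => i1 a,
    integral_finsetSum _ fun a _ => integrable_finsetSum _ fun b _ => i2 a b]
  simp only [fun a => integral_finsetSum Finset.univ fun b _ => i2 a b]
  calc _ ≤ S ^ 2 + ∑ _a : Fin 3, S ^ 2 + ∑ _a : Fin 3, ∑ _b : Fin 3, S ^ 2 := by
        gcongr with a _ a _ b _
        · exact h1 a
        · exact h2 a b
    _ = _ := by simp; ring

/-- Klainerman–Sobolev inequality on hyperboloids. -/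
theorem stmt_4 : ∃ C > (0:ℝ), ∀ (s₀ s₁ : ℝ), 2 ≤ s₀ → s₀ ≤ s₁ →
    ∀ u : (Fin 4 → ℝ) → ℝ, ContDiff ℝ (⊤ : ℕ∞) u → vanishNearBdry u →
      ∀ s ∈ Set.Icc s₀ s₁, ∀ x : Fin 3 → ℝ, rad (hpt s x) < hpt s x 0 - 1 →
        (hpt s x 0) ^ ((3:ℝ)/2) * |u (hpt s x)|
          ≤ C * ∑ n ∈ Finset.range 3, ∑ m ∈ Finset.range (3 - n),
              ∑ I : Fin n → Fin 4, ∑ J : Fin m → Fin 3,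
                L2f s (pdIter n I (LIter m J u)) := by
  set σ := (volume : Measure (Fin 3 → ℝ)).toSphere.real Set.univ with hσ
  have hσ0 : 0 < σ := by
    rw [hσ, Measure.toSphere_real_apply_univ]
    exact mul_pos (by simp) (ENNReal.toReal_pos
      (Metric.measure_ball_pos _ _ one_pos).ne' measure_ball_lt_top.ne)
  refine ⟨Real.sqrt (6292 * 13 / σ), Real.sqrt_pos.2 (by positivity), ?_⟩
  rintro s₀ s₁ hs₀ - u hu ⟨δ, hδ, hvan⟩ s hs x -
  have hs0 : 0 < s := by linarith [hs.1]
  have hc : SmoothInCone δ u := ⟨hu, fun p hp => hvan p hp.le⟩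
  have ht := hpt_zero_pos hs0 x
  have key := (mul_toSphere_le_integral (by positivity) (by positivity)
    (hc.continuous_boostDensity s) (boostDensity_nonneg s u)
    (hc.integrable_boostDensity hδ hs0) x fun ω hω => hc.cube_mul_sq_le hs0 x hω).trans
    (hc.integral_boostDensity_le hδ hs0)
  have hS := (Real.sqrt_nonneg _).trans (L2f_LIter_le s u (m := 0) (by norm_num) ![])
  set S := ∑ n ∈ Finset.range 3, ∑ m ∈ Finset.range (3 - n),
    ∑ I : Fin n → Fin 4, ∑ J : Fin m → Fin 3, L2f s (pdIter n I (LIter m J u))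
  refine le_of_sq_le_sq ?_ (by positivity)
  have hpow : (hpt s x 0 ^ ((3:ℝ) / 2)) ^ 2 = hpt s x 0 ^ 3 := by
    rw [← Real.rpow_natCast, ← Real.rpow_mul ht.le, ← Real.rpow_natCast]
    norm_num
  rw [mul_pow, mul_pow, hpow, sq_abs, Real.sq_sqrt (by positivity), div_mul_eq_mul_div,
    le_div_iff₀ hσ0]
  rw [← hσ] at key
  linarith
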